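/- Let X₁, X₂, A be finite nonempty types, let p : X₁ × X₂ → ℝ be a probability mass function (p ≥ 0, ∑ p = 1), let μ assign to each pair (x₁, x₂) a probability mass function over A with μ(a|x₁,x₂) > 0 for all a, and define the marginal p₁(x₁) := ∑_{x₂} p(x₁,x₂) and, for each x₁ with p₁(x₁) > 0, the marginalized policy π̂(a|x₁) := (∑_{x₂} p(x₁,x₂)·μ(a|x₁,x₂)) / p₁(x₁). Then for every map π assigning to each x₁ a probability mass function over A with π(a|x₁) > 0 for all a, the expected Kullback-Leibler divergence is minimized by π̂: ∑_{x₁,x₂} p(x₁,x₂) · ∑_a μ(a|x₁,x₂) · log(μ(a|x₁,x₂)/π(a|x₁)) ≥ ∑_{x₁,x₂} p(x₁,x₂) · ∑_a μ(a|x₁,x₂) · log(μ(a|x₁,x₂)/π̂(a|x₁)). -/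

import Mathlib

/-- **The marginalized policy minimizes the expected KL divergence (IML optimum).**
For a context distribution `p` on `X₁ × X₂` and a strictly positive logging policy `μ`,
the marginalized policy `π̂(a|x₁) = (∑_{x₂} p(x₁,x₂)·μ(a|x₁,x₂)) / p₁(x₁)` minimizes
`E KL(μ‖π)` over all strictly positive policies `π` that depend only on `x₁`. -/
theorem marginalized_policy_minimizes_KL {X₁ X₂ A : Type*}
    [Fintype X₁] [Fintype X₂] [Fintype A] [Nonempty X₁] [Nonempty X₂] [Nonempty A]
    (p : X₁ × X₂ → ℝ) (hp : ∀ x, 0 ≤ p x) (hp1 : ∑ x, p x = 1)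
    (μ : X₁ × X₂ → A → ℝ)
    (hμpos : ∀ x a, 0 < μ x a) (hμsum : ∀ x, ∑ a, μ x a = 1)
    (π : X₁ → A → ℝ)
    (hπpos : ∀ x₁ a, 0 < π x₁ a) (hπsum : ∀ x₁, ∑ a, π x₁ a = 1) :
    ∑ x₁, ∑ x₂, p (x₁, x₂) * ∑ a, μ (x₁, x₂) a * Real.log (μ (x₁, x₂) a / π x₁ a) ≥
      ∑ x₁, ∑ x₂, p (x₁, x₂) * ∑ a, μ (x₁, x₂) a *
        Real.log (μ (x₁, x₂) a /
          ((∑ x₂', p (x₁, x₂') * μ (x₁, x₂') a) / (∑ x₂', p (x₁, x₂')))) := by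
  refine Finset.sum_le_sum fun x₁ _ => ?_
  have hP0 : 0 ≤ ∑ x₂, p (x₁, x₂) := Finset.sum_nonneg fun _ _ => hp _
  rcases hP0.eq_or_lt with h0 | hP
  · have hz : ∀ x₂, p (x₁, x₂) = 0 := fun x₂ =>
      (Finset.sum_eq_zero_iff_of_nonneg fun _ _ => hp _).1 h0.symm x₂ (Finset.mem_univ _)
    simp [hz]
  · set P := ∑ x₂, p (x₁, x₂) with hPdef
    have hS : ∀ a, 0 < ∑ x₂, p (x₁, x₂) * μ (x₁, x₂) a := by
      intro a
      obtain ⟨y, hy, hy'⟩ := Finset.exists_lt_of_sum_lt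
        (s := Finset.univ) (f := fun _ : X₂ => (0 : ℝ)) (g := fun x₂ => p (x₁, x₂))
        (by simpa using hP)
      exact Finset.sum_pos' (fun x₂ _ => mul_nonneg (hp _) (hμpos _ _).le)
        ⟨y, hy, mul_pos hy' (hμpos _ _)⟩
    have key : ∑ x₂, p (x₁, x₂) * ∑ a, μ (x₁, x₂) a *
        (1 - π x₁ a / ((∑ x₂', p (x₁, x₂') * μ (x₁, x₂') a) / P)) = 0 := by
      simp_rw [Finset.mul_sum, ← mul_assoc]
      rw [Finset.sum_comm]
      simp_rw [← Finset.sum_mul]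
      have h1 : ∀ a, (∑ x₂, p (x₁, x₂) * μ (x₁, x₂) a) *
          (1 - π x₁ a / ((∑ x₂', p (x₁, x₂') * μ (x₁, x₂') a) / P)) =
          (∑ x₂, p (x₁, x₂) * μ (x₁, x₂) a) - π x₁ a * P := by
        intro a
        have := (hS a).ne'
        field_simp
      simp_rw [h1]
      rw [Finset.sum_sub_distrib, ← Finset.sum_mul, hπsum, Finset.sum_comm]
      simp_rw [← Finset.mul_sum, hμsum]
      simp [hPdef]
    rw [← sub_zero (∑ x₂, p (x₁, x₂) * ∑ a, μ (x₁, x₂) a *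
      Real.log (μ (x₁, x₂) a / π x₁ a)), ← key, ← Finset.sum_sub_distrib]
    refine Finset.sum_le_sum fun x₂ _ => ?_
    rw [← mul_sub, ← Finset.sum_sub_distrib]
    refine mul_le_mul_of_nonneg_left (Finset.sum_le_sum fun a _ => ?_) (hp _)
    rw [← mul_sub]
    refine mul_le_mul_of_nonneg_left ?_ (hμpos _ _).le
    have hq : 0 < (∑ x₂', p (x₁, x₂') * μ (x₁, x₂') a) / P := div_pos (hS a) hP
    have hπ := hπpos x₁ a
    rw [Real.log_div (hμpos _ _).ne' hq.ne', Real.log_div (hμpos _ _).ne' hπ.ne']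
    have := Real.log_le_sub_one_of_pos (div_pos hπ hq)
    rw [Real.log_div hπ.ne' hq.ne'] at this
    linarith
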